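/- Let k ∈ ℂ∖{0} with either k ∈ ℝ or |k| = 1. Let g₀ : [0,∞) → ℂ be continuously differentiable and bounded with g₀(t) → 0 as t → ∞, and let h₀ : [0,∞) → ℂ be continuous. Suppose η = (η₁,η₂) : [0,∞) → ℂ² is differentiable, satisfies η₁′ − (i/2)(k⁻¹+k)η₁ = V₀¹¹(t,k)η₁ + V₀¹²(t,k)η₂ and η₂′ = V₀²¹(t,k)η₁ − V₀¹¹(t,k)η₂ on (0,∞) with η(t) → (0,1) as t → ∞, and suppose η̂ = (η̂₁,η̂₂) : [0,∞) → ℂ² is differentiable, satisfies the same system with k replaced by k̄, and η̂(t) → (0,1) as t → ∞. Define A := η₂(0), B := η₁(0), Ã := conj(η̂₂(0)) − ḡ₀(0)·conj(η̂₁(0)), and B̃ := g₀(0)·conj(η̂₂(0)) − (k + |g₀(0)|²)·conj(η̂₁(0)). Then A Ã − B B̃ = 1. -/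

import Mathlib

open Complex Filter

noncomputable section

/-- `|w|²` as a complex number. -/
def nsq (w : ℂ) : ℂ := (Complex.normSq w : ℂ)

/-- complex conjugation. -/
def cj (w : ℂ) : ℂ := (starRingEnd ℂ) w

/-- the `(1,1)` entry of `V₀(t,k)`. -/
def V011 (g₀ h₀ : ℝ → ℂ) (k : ℂ) (t : ℝ) : ℂ :=
  (Complex.I / 4) * (nsq (g₀ t) - nsq (h₀ t)) + (Complex.I / (2 * k)) * (g₀ t * cj (h₀ t))

/-- the `(1,2)` entry of `V₀(t,k)`. -/
def V012 (g₀ h₀ : ℝ → ℂ) (k : ℂ) (t : ℝ) : ℂ :=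
  -(Complex.I / 2) * cj (g₀ t) - (Complex.I / (2 * k)) * cj (h₀ t)

/-- the `(2,1)` entry of `V₀(t,k)`; `g₀'` is the derivative within `[0,∞)`. -/
def V021 (g₀ h₀ : ℝ → ℂ) (k : ℂ) (t : ℝ) : ℂ :=
  derivWithin g₀ (Set.Ici 0) t - (Complex.I / 2) * g₀ t * nsq (h₀ t)
    - (Complex.I / 2) * h₀ t
    + (Complex.I / (2 * k)) * (g₀ t + (g₀ t) ^ 2 * cj (h₀ t))

/-- A function on `[0,∞)` that is continuous, has zero derivative on `(0,∞)` and tends to `c` at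
infinity takes the value `c` at `0`. -/
theorem apply_zero_eq_of_hasDerivAt_zero_of_tendsto {E : Type*} [NormedAddCommGroup E]
    [NormedSpace ℝ E] {f : ℝ → E} {c : E} (hf : ContinuousOn f (Set.Ici 0))
    (hd : ∀ t ∈ Set.Ioi (0 : ℝ), HasDerivAt f 0 t) (hl : Tendsto f atTop (nhds c)) :
    f 0 = c := by
  have hconst : ∀ x ∈ Set.Ioi (0 : ℝ), ∀ y ∈ Set.Ioi (0 : ℝ), f x = f y := fun x hx y hy =>
    isOpen_Ioi.is_const_of_deriv_eq_zero isPreconnected_Ioi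
      (fun t ht => (hd t ht).differentiableAt.differentiableWithinAt)
      (fun t ht => (hd t ht).deriv) hx hy
  have hval : ∀ x ∈ Set.Ioi (0 : ℝ), f x = c := fun x hx => by
    refine tendsto_nhds_unique (tendsto_const_nhds.congr' ?_) hl
    filter_upwards [eventually_gt_atTop 0] with y hy using hconst x hx y hy
  have h0 : Tendsto f (nhdsWithin 0 (Set.Ioi 0)) (nhds (f 0)) :=
    (hf 0 Set.self_mem_Ici).mono_left (nhdsWithin_mono _ Set.Ioi_subset_Ici_self)
  refine tendsto_nhds_unique h0 (tendsto_const_nhds.congr' ?_)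
  filter_upwards [self_mem_nhdsWithin] with y hy using (hval y hy).symm

theorem continuous_cj : Continuous cj := Complex.continuous_conj

theorem nsq_eq_mul_cj (w : ℂ) : nsq w = w * cj w := (Complex.mul_conj w).symm

theorem HasDerivAt.cj {f : ℝ → ℂ} {f' : ℂ} {t : ℝ} (h : HasDerivAt f f' t) :
    HasDerivAt (fun s => cj (f s)) (cj f') t := h.star

/-- for `k ≠ 0` with `k` real or `|k| = 1`, the boundary spectral
functions built from the solutions `η` (parameter `k`) and `ηh` (parameter `k̄`)
of the `t`-ODE normalized at infinity obey `A Ã − B B̃ = 1`. -/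
theorem t_spectral_functions_det_one
    (k : ℂ) (hk : k ≠ 0) (hkr : k.im = 0 ∨ ‖k‖ = 1)
    (g₀ h₀ : ℝ → ℂ)
    (hg₀ : ContDiffOn ℝ 1 g₀ (Set.Ici 0))
    (hg₀b : ∃ C : ℝ, ∀ t ∈ Set.Ici (0 : ℝ), ‖g₀ t‖ ≤ C)
    (hg₀0 : Tendsto g₀ atTop (nhds 0))
    (hh₀ : ContinuousOn h₀ (Set.Ici 0))
    (η₁ η₂ ηh₁ ηh₂ : ℝ → ℂ)
    (hη₁c : ContinuousOn η₁ (Set.Ici 0)) (hη₂c : ContinuousOn η₂ (Set.Ici 0))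
    (hηh₁c : ContinuousOn ηh₁ (Set.Ici 0)) (hηh₂c : ContinuousOn ηh₂ (Set.Ici 0))
    (hode : ∀ t ∈ Set.Ioi (0 : ℝ),
      HasDerivAt η₁
        ((Complex.I / 2) * (k⁻¹ + k) * η₁ t
          + V011 g₀ h₀ k t * η₁ t + V012 g₀ h₀ k t * η₂ t) t ∧
      HasDerivAt η₂ (V021 g₀ h₀ k t * η₁ t - V011 g₀ h₀ k t * η₂ t) t)
    (hlim : Tendsto (fun t => (η₁ t, η₂ t)) atTop (nhds (0, 1)))
    (hode' : ∀ t ∈ Set.Ioi (0 : ℝ),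
      HasDerivAt ηh₁
        ((Complex.I / 2) * ((cj k)⁻¹ + cj k) * ηh₁ t
          + V011 g₀ h₀ (cj k) t * ηh₁ t + V012 g₀ h₀ (cj k) t * ηh₂ t) t ∧
      HasDerivAt ηh₂ (V021 g₀ h₀ (cj k) t * ηh₁ t - V011 g₀ h₀ (cj k) t * ηh₂ t) t)
    (hlim' : Tendsto (fun t => (ηh₁ t, ηh₂ t)) atTop (nhds (0, 1))) :
    (η₂ 0) * (cj (ηh₂ 0) - cj (g₀ 0) * cj (ηh₁ 0))
      - (η₁ 0) * (g₀ 0 * cj (ηh₂ 0) - (k + nsq (g₀ 0)) * cj (ηh₁ 0)) = 1 := by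
  have hgc := hg₀.continuousOn
  have conj_cont : ∀ {f : ℝ → ℂ}, ContinuousOn f (Set.Ici 0) →
      ContinuousOn (fun t => cj (f t)) (Set.Ici 0) := fun h => continuous_cj.comp_continuousOn h
  have conj_tendsto : ∀ {f : ℝ → ℂ} {c : ℂ}, Tendsto f atTop (nhds c) →
      Tendsto (fun t => cj (f t)) atTop (nhds (cj c)) := fun h =>
    (continuous_cj.tendsto _).comp h
  simp only [nsq_eq_mul_cj]
  refine apply_zero_eq_of_hasDerivAt_zero_of_tendsto
    (f := fun t => η₂ t * (cj (ηh₂ t) - cj (g₀ t) * cj (ηh₁ t))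
      - η₁ t * (g₀ t * cj (ηh₂ t) - (k + g₀ t * cj (g₀ t)) * cj (ηh₁ t))) ?_ ?_ ?_
  · exact (hη₂c.mul ((conj_cont hηh₂c).sub ((conj_cont hgc).mul (conj_cont hηh₁c)))).sub
      (hη₁c.mul ((hgc.mul (conj_cont hηh₂c)).sub
        ((continuousOn_const.add (hgc.mul (conj_cont hgc))).mul (conj_cont hηh₁c))))
  · intro t ht
    have hg : HasDerivAt g₀ (derivWithin g₀ (Set.Ici 0) t) t :=
      ((hg₀.differentiableOn one_ne_zero) t
        (Set.Ioi_subset_Ici_self ht)).hasDerivWithinAt.hasDerivAt (Ici_mem_nhds ht)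
    obtain ⟨h₁, h₂⟩ := hode t ht
    obtain ⟨hh₁, hh₂⟩ := hode' t ht
    refine ((h₂.mul (hh₂.cj.sub (hg.cj.mul hh₁.cj))).sub
      (h₁.mul ((hg.mul hh₂.cj).sub
        (((hg.mul hg.cj).const_add k).mul hh₁.cj)))).congr_deriv ?_
    simp only [V011, V012, V021, nsq_eq_mul_cj]
    simp only [cj, map_add, map_sub, map_mul, map_neg, map_div₀, map_inv₀, map_pow,
      Complex.conj_conj, Complex.conj_I, map_ofNat, Pi.mul_apply, Pi.sub_apply]
    field_simp
    ring
  · have l₁ := (Prod.tendsto_iff _ _).1 hlim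
    have l₂ := (Prod.tendsto_iff _ _).1 hlim'
    have hg := conj_tendsto hg₀0
    have m₁ := conj_tendsto l₂.1
    have m₂ := conj_tendsto l₂.2
    have key := (l₁.2.mul (m₂.sub (hg.mul m₁))).sub
      (l₁.1.mul ((hg₀0.mul m₂).sub (((hg₀0.mul hg).const_add k).mul m₁)))
    simpa [cj] using key
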